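/- For every integer n ≥ 0, the map sending q to (2n+2)⌊q/(n+1)⌋ − q is an order isomorphism from the poset Q_n onto the poset P_{n+1, 2n+1}. -/

import Mathlib

def NRep (a b n : ℕ) : Prop := ∃ s t : ℕ, n = s * a + t * b
def PosetMem (a b p : ℕ) : Prop := 0 < p ∧ ¬ NRep a b p
def PosetLe (a b q p : ℕ) : Prop := ∃ s t : ℕ, p = q + s * a + t * b

/-- The underlying set of `Q_n = P_{n+1, 2n+3} \ {1, …, n}`. -/
def QnSet (n : ℕ) : Set ℕ := {q | PosetMem (n + 1) (2 * n + 3) q ∧ n < q}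

lemma aux_c_nonneg (m t d c : ℤ) (hd : d < m) (ht : 0 ≤ t) (h : t = d + c * m) (hm : 0 < m) :
    0 ≤ c := by
  by_contra hc
  nlinarith

lemma aux_repQ (n k r : ℕ) (hr : r < n + 1) :
    NRep (n + 1) (2 * n + 3) (k * (n + 1) + r) ↔ 2 * r ≤ k := by
  constructor
  · rintro ⟨s, t, h⟩
    zify at *
    have h1 : (t : ℤ) = r + (k - s - 2 * t) * (n + 1) := by linarith
    have hc := aux_c_nonneg (n + 1) t r _ hr (by positivity) h1 (by positivity)
    have : (r : ℤ) ≤ t := by nlinarith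
    have : (0 : ℤ) ≤ s := by positivity
    linarith
  · intro h
    obtain ⟨s, rfl⟩ := Nat.exists_eq_add_of_le h
    exact ⟨s, r, by ring⟩

lemma aux_repP (n k r p : ℕ) (hr : r < n + 1) (hp : p + r = k * (n + 1)) :
    NRep (n + 1) (2 * n + 1) p ↔ 2 * r ≤ k := by
  constructor
  · rintro ⟨s, t, h⟩
    zify at *
    have h1 : (t : ℤ) = r + (s + 2 * t - k) * (n + 1) := by linarith
    have hc := aux_c_nonneg (n + 1) t r _ hr (by positivity) h1 (by positivity)
    have : (0 : ℤ) ≤ s := by positivity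
    have h2 : (k : ℤ) = s + 2 * t - (s + 2 * t - k) := by ring
    generalize (s + 2 * t - k : ℤ) = c at *
    have : 0 ≤ c * n := by positivity
    nlinarith
  · intro h
    obtain ⟨s, rfl⟩ := Nat.exists_eq_add_of_le h
    exact ⟨s, r, by linarith⟩

lemma aux_leQ (n k r k' r' : ℕ) (hr : r < n + 1) (hr' : r' < n + 1) (hk' : k' < 2 * r') :
    PosetLe (n + 1) (2 * n + 3) (k * (n + 1) + r) (k' * (n + 1) + r') ↔
      r ≤ r' ∧ k + 2 * r' ≤ k' + 2 * r := by
  constructor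
  · rintro ⟨s, t, h⟩
    zify at *
    have h1 : (t : ℤ) = (r' - r) + (k' - k - s - 2 * t) * (n + 1) := by linarith
    have hc := aux_c_nonneg (n + 1) t (r' - r) _ (by linarith) (by positivity) h1 (by positivity)
    have hs : (0 : ℤ) ≤ s := by positivity
    have hk : (0 : ℤ) ≤ k := by positivity
    have ht : (0 : ℤ) ≤ t := by positivity
    have h2 : (k' : ℤ) = k + s + 2 * t + (k' - k - s - 2 * t) := by ring
    generalize (k' - k - s - 2 * t : ℤ) = c at *
    rcases hc.eq_or_lt with rfl | hc
    · constructor <;> linarith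
    · exfalso
      nlinarith
  · rintro ⟨h1, h2⟩
    obtain ⟨t, rfl⟩ := Nat.exists_eq_add_of_le h1
    obtain ⟨s, rfl⟩ : ∃ s, k' = k + 2 * t + s := ⟨k' - k - 2 * t, by omega⟩
    exact ⟨s, t, by ring⟩

lemma aux_leP (n k r k' r' q p : ℕ) (hr : r < n + 1) (hr' : r' < n + 1) (hk' : k' < 2 * r')
    (hk : 1 ≤ k) (hq : q + r = k * (n + 1)) (hp : p + r' = k' * (n + 1)) :
    PosetLe (n + 1) (2 * n + 1) q p ↔ r ≤ r' ∧ k + 2 * r' ≤ k' + 2 * r := by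
  constructor
  · rintro ⟨s, t, h⟩
    zify at *
    have h1 : (t : ℤ) = (r' - r) + (k + s + 2 * t - k') * (n + 1) := by linarith
    have hc := aux_c_nonneg (n + 1) t (r' - r) _ (by linarith) (by positivity) h1 (by positivity)
    have hs : (0 : ℤ) ≤ s := by positivity
    have ht : (0 : ℤ) ≤ t := by positivity
    have h2 : (k' : ℤ) = k + s + 2 * t - (k + s + 2 * t - k') := by ring
    generalize (k + s + 2 * t - k' : ℤ) = c at *
    rcases hc.eq_or_lt with rfl | hc
    · constructor <;> linarith
    · exfalso
      have hn : (0 : ℤ) ≤ (c - 1) * n := mul_nonneg (by linarith) (by positivity)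
      nlinarith
  · rintro ⟨h1, h2⟩
    obtain ⟨t, rfl⟩ := Nat.exists_eq_add_of_le h1
    obtain ⟨s, rfl⟩ : ∃ s, k' = k + 2 * t + s := ⟨k' - k - 2 * t, by omega⟩
    exact ⟨s, t, by linarith⟩

lemma aux_memQ (n q : ℕ) : q ∈ QnSet n ↔
    ∃ k r, 1 ≤ k ∧ r < n + 1 ∧ k < 2 * r ∧ q = k * (n + 1) + r := by
  constructor
  · rintro ⟨⟨_, h⟩, hq⟩
    have e : q = q / (n + 1) * (n + 1) + q % (n + 1) := (Nat.div_add_mod' q (n + 1)).symm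
    have hr : q % (n + 1) < n + 1 := Nat.mod_lt _ (by omega)
    rw [e, aux_repQ n _ _ hr] at h
    exact ⟨q / (n + 1), q % (n + 1), Nat.div_pos hq (by omega), hr, by omega, e⟩
  · rintro ⟨k, r, hk, hr, h, rfl⟩
    have : n + 1 ≤ k * (n + 1) := Nat.le_mul_of_pos_left _ hk
    refine ⟨⟨by omega, ?_⟩, by omega⟩
    rw [aux_repQ n _ _ hr]
    omega

lemma aux_memP (n p : ℕ) : PosetMem (n + 1) (2 * n + 1) p ↔
    ∃ k r, 1 ≤ k ∧ r < n + 1 ∧ k < 2 * r ∧ p + r = k * (n + 1) := by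
  constructor
  · rintro ⟨h0, h⟩
    have e : (p + n) / (n + 1) * (n + 1) + (p + n) % (n + 1) = p + n := Nat.div_add_mod' _ _
    have hr : (p + n) % (n + 1) < n + 1 := Nat.mod_lt _ (by omega)
    have e2 : p + (n - (p + n) % (n + 1)) = (p + n) / (n + 1) * (n + 1) := by omega
    rw [aux_repP n _ _ p (by omega) e2] at h
    exact ⟨_, _, Nat.div_pos (by omega) (by omega), by omega, by omega, e2⟩
  · rintro ⟨k, r, hk, hr, h, hp⟩
    have : n + 1 ≤ k * (n + 1) := Nat.le_mul_of_pos_left _ hk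
    refine ⟨by omega, ?_⟩
    rw [aux_repP n _ _ p hr hp]
    omega

lemma aux_map (n k r : ℕ) (hk : 1 ≤ k) (hr : r < n + 1) :
    (2 * n + 2) * ((k * (n + 1) + r) / (n + 1)) - (k * (n + 1) + r) + r = k * (n + 1) := by
  have : (k * (n + 1) + r) / (n + 1) = k := by
    rw [Nat.div_eq_iff (by omega)]
    constructor <;> omega
  rw [this]
  have h1 : n + 1 ≤ k * (n + 1) := Nat.le_mul_of_pos_left _ hk
  have h2 : (2 * n + 2) * k = k * (n + 1) + k * (n + 1) := by ring
  omega

/-- For every `n ≥ 0`, the map `q ↦ (2n+2)⌊q/(n+1)⌋ − q` is an order isomorphism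
from the poset `Q_n` (with the order induced from `P_{n+1, 2n+3}`) onto the
poset `P_{n+1, 2n+1}`. -/
theorem Qn_orderIso_P (n : ℕ) :
    Set.BijOn (fun q => (2 * n + 2) * (q / (n + 1)) - q) (QnSet n)
        {p | PosetMem (n + 1) (2 * n + 1) p} ∧
      ∀ q ∈ QnSet n, ∀ p ∈ QnSet n,
        (PosetLe (n + 1) (2 * n + 3) q p ↔
          PosetLe (n + 1) (2 * n + 1) ((2 * n + 2) * (q / (n + 1)) - q)
            ((2 * n + 2) * (p / (n + 1)) - p)) := by
  have key : ∀ q ∈ QnSet n, ∀ p ∈ QnSet n,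
        (PosetLe (n + 1) (2 * n + 3) q p ↔
          PosetLe (n + 1) (2 * n + 1) ((2 * n + 2) * (q / (n + 1)) - q)
            ((2 * n + 2) * (p / (n + 1)) - p)) := by
    intro q hq p hp
    obtain ⟨k, r, hk, hr, h, rfl⟩ := (aux_memQ n q).1 hq
    obtain ⟨k', r', hk', hr', h', rfl⟩ := (aux_memQ n p).1 hp
    rw [aux_leQ n k r k' r' hr hr' h', aux_leP n k r k' r' _ _ hr hr' h' hk
      (aux_map n k r hk hr) (aux_map n k' r' hk' hr')]
  refine ⟨⟨?_, ?_, ?_⟩, key⟩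
  · intro q hq
    obtain ⟨k, r, hk, hr, h, rfl⟩ := (aux_memQ n q).1 hq
    exact (aux_memP n _).2 ⟨k, r, hk, hr, h, aux_map n k r hk hr⟩
  · intro q hq p hp e
    have e' : (2 * n + 2) * (q / (n + 1)) - q = (2 * n + 2) * (p / (n + 1)) - p := e
    obtain ⟨s, t, h1⟩ := (key q hq p hp).2 ⟨0, 0, by omega⟩
    obtain ⟨s', t', h2⟩ := (key p hp q hq).2 ⟨0, 0, by omega⟩
    have : q ≤ p := by rw [h1, add_assoc]; exact Nat.le_add_right _ _
    have : p ≤ q := by rw [h2, add_assoc]; exact Nat.le_add_right _ _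
    omega
  · intro p hp
    obtain ⟨k, r, hk, hr, h, e⟩ := (aux_memP n p).1 hp
    refine ⟨k * (n + 1) + r, (aux_memQ n _).2 ⟨k, r, hk, hr, h, rfl⟩, ?_⟩
    have := aux_map n k r hk hr
    show (2 * n + 2) * ((k * (n + 1) + r) / (n + 1)) - (k * (n + 1) + r) = p
    omega
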